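/- arXiv:1905.04512 — 3 statements merged into one kernel-verified Lean document; each statement's English description precedes it below -/
import Mathlib

section
/- Fix a real constant b ≠ 0 and work on the open region U = {(x,y,z) ∈ ℝ³ : b(y+z) < 0}. With Ei(w) = ∫_w^∞ e^{−t}/t dt for w > 0, the vector fields X₁ = (−b, 0, 0), X₂ = (−½ + ½e^{b(y−z)} − b y, 0, (y+z)e^{b(y−z)}), and X₃ = (b·e^{−b(y+z)}·Ei(−b(y+z)), −1, 2b(y+z)·Ei(−b(y+z))·e^{−b(y+z)} + 1) satisfy [X₂, X₃] = X₁, [X₁, X₂] = 0 and [X₁, X₃] = 0 on U, so they span a Lie algebra isomorphic to the three-dimensional Heisenberg Lie algebra. -/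
open Real

/-- The exponential integral `Ei(w) = ∫_w^∞ e^{−t}/t dt` (for `w > 0`). -/
noncomputable def Ei (w : ℝ) : ℝ := ∫ t in Set.Ioi w, exp (-t) / t

/-- The Lie bracket of vector fields on (an open subset of) `ℝ³`:
`[X,Y](p) = DY(p)(X(p)) − DX(p)(Y(p))`. -/
noncomputable def lieBr (X Y : (Fin 3 → ℝ) → (Fin 3 → ℝ)) (p : Fin 3 → ℝ) : Fin 3 → ℝ :=
  fderiv ℝ Y p (X p) - fderiv ℝ X p (Y p)

/-- X₁ = (−b, 0, 0). -/
noncomputable def X₁ (b : ℝ) : (Fin 3 → ℝ) → (Fin 3 → ℝ) := fun _ => ![-b, 0, 0]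

/-- X₂ = (−½ + ½e^{b(y−z)} − b y, 0, (y+z)e^{b(y−z)}). -/
noncomputable def X₂ (b : ℝ) : (Fin 3 → ℝ) → (Fin 3 → ℝ) := fun p =>
  ![-(1/2) + (1/2) * exp (b * (p 1 - p 2)) - b * p 1, 0,
    (p 1 + p 2) * exp (b * (p 1 - p 2))]

/-- X₃ = (b·e^{−b(y+z)}·Ei(−b(y+z)), −1, 2b(y+z)·Ei(−b(y+z))·e^{−b(y+z)} + 1). -/
noncomputable def X₃ (b : ℝ) : (Fin 3 → ℝ) → (Fin 3 → ℝ) := fun p =>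
  ![b * exp (-b * (p 1 + p 2)) * Ei (-b * (p 1 + p 2)), -1,
    2 * b * (p 1 + p 2) * Ei (-b * (p 1 + p 2)) * exp (-b * (p 1 + p 2)) + 1]

open MeasureTheory in
lemma integrableOn_exp_neg_div_Ioi {a : ℝ} (ha : 0 < a) :
    IntegrableOn (fun t : ℝ => exp (-t) / t) (Set.Ioi a) := by
  have h : IntegrableOn (fun t : ℝ => exp (-t) * a⁻¹) (Set.Ioi a) :=
    (integrableOn_exp_neg_Ioi a).mul_const a⁻¹
  refine h.mono' (Measurable.aestronglyMeasurable (by fun_prop)) ?_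
  filter_upwards [ae_restrict_mem measurableSet_Ioi] with t ht
  have ht' : a < t := ht
  have ht0 : 0 < t := ha.trans ht'
  rw [norm_of_nonneg (by positivity), div_eq_mul_inv]
  gcongr

lemma hasDerivAt_Ei {w : ℝ} (hw : 0 < w) : HasDerivAt Ei (-(exp (-w) / w)) w := by
  have hcont : ∀ t ∈ Set.Ioi (0 : ℝ), ContinuousAt (fun t : ℝ => exp (-t) / t) t :=
    fun t ht => ContinuousAt.div (by fun_prop) (by fun_prop) (ne_of_gt ht)
  have hw2 : 0 < w / 2 := by positivity
  have hint : ∀ u, 0 < u → IntervalIntegrable (fun t : ℝ => exp (-t) / t)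
      MeasureTheory.volume (w / 2) u := fun u hu =>
    ContinuousOn.intervalIntegrable fun t ht =>
      (hcont t (lt_of_lt_of_le (lt_min hw2 hu) ht.1)).continuousWithinAt
  have h := intervalIntegral.integral_hasDerivAt_right (hint w hw)
    (ContinuousAt.stronglyMeasurableAtFilter isOpen_Ioi hcont w hw) (hcont w hw)
  refine (h.const_sub (Ei (w / 2))).congr_of_eventuallyEq ?_
  filter_upwards [Ioi_mem_nhds hw] with u hu
  have := intervalIntegral.integral_interval_add_Ioi
    (integrableOn_exp_neg_div_Ioi hw2) (integrableOn_exp_neg_div_Ioi hu)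
  simp only [Ei]
  linarith

lemma hasDerivAt_exp_mul_Ei {b s : ℝ} (hs : b * s < 0) :
    HasDerivAt (fun s => exp (-b * s) * Ei (-b * s)) (-b * (exp (-b * s) * Ei (-b * s)) - 1 / s)
      s := by
  have hb : b ≠ 0 := left_ne_zero_of_mul hs.ne
  have hs0 : s ≠ 0 := right_ne_zero_of_mul hs.ne
  have hlin : HasDerivAt (fun s : ℝ => -b * s) (-b) s := by
    simpa using (hasDerivAt_id s).const_mul (-b)
  have hEi := (hasDerivAt_Ei (w := -b * s) (by linarith)).comp s hlin
  refine (hlin.exp.mul hEi).congr_deriv ?_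
  have hexp : exp (-b * s) * exp (-(-b * s)) = 1 := by rw [← exp_add]; simp
  simp only [Function.comp_apply, neg_mul, neg_neg] at hexp ⊢
  field_simp
  linear_combination (-1) * hexp

lemma fderiv_X₁ (b : ℝ) (p : Fin 3 → ℝ) : fderiv ℝ (X₁ b) p = 0 := by
  unfold X₁
  simp

lemma fderiv_vec3_apply {E : Type*} [NormedAddCommGroup E] [NormedSpace ℝ E]
    {f g h : E → ℝ} {f' g' h' : E →L[ℝ] ℝ} {p : E} (hf : HasFDerivAt f f' p)
    (hg : HasFDerivAt g g' p) (hh : HasFDerivAt h h' p) (v : E) :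
    fderiv ℝ (fun q => ![f q, g q, h q]) p v = ![f' v, g' v, h' v] := by
  have H : HasFDerivAt (fun q => ![f q, g q, h q])
      (ContinuousLinearMap.pi ![f', g', h']) p := by
    refine hasFDerivAt_pi'' fun i => ?_
    fin_cases i
    · exact hf
    · exact hg
    · exact hh
  rw [H.fderiv]
  ext i
  fin_cases i <;> rfl

lemma fderiv_X₂_apply (b : ℝ) (p v : Fin 3 → ℝ) :
    fderiv ℝ (X₂ b) p v =
      ![b / 2 * exp (b * (p 1 - p 2)) * (v 1 - v 2) - b * v 1, 0,
        exp (b * (p 1 - p 2)) * (v 1 + v 2 + b * (p 1 + p 2) * (v 1 - v 2))] := by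
  have h1 := hasFDerivAt_apply (𝕜 := ℝ) (1 : Fin 3) p
  have h2 := hasFDerivAt_apply (𝕜 := ℝ) (2 : Fin 3) p
  have hE := ((h1.fun_sub h2).const_mul b).exp
  unfold X₂
  rw [fderiv_vec3_apply (((hE.const_mul (1 / 2)).const_add (-(1 / 2))).fun_sub (h1.const_mul b))
    (hasFDerivAt_const (0 : ℝ) p) ((h1.fun_add h2).fun_mul hE)]
  ext i
  fin_cases i <;> simp <;> ring

lemma fderiv_X₃_apply {b : ℝ} {p : Fin 3 → ℝ} (hp : b * (p 1 + p 2) < 0) (v : Fin 3 → ℝ) :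
    fderiv ℝ (X₃ b) p v =
      ![(-b * (exp (-b * (p 1 + p 2)) * Ei (-b * (p 1 + p 2))) - 1 / (p 1 + p 2)) * b *
          (v 1 + v 2), 0,
        2 * b * ((1 - b * (p 1 + p 2)) * (exp (-b * (p 1 + p 2)) * Ei (-b * (p 1 + p 2))) - 1) *
          (v 1 + v 2)] := by
  have hs : p 1 + p 2 ≠ 0 := right_ne_zero_of_mul hp.ne
  have h12 := (hasFDerivAt_apply (𝕜 := ℝ) (1 : Fin 3) p).fun_add
    (hasFDerivAt_apply (𝕜 := ℝ) (2 : Fin 3) p)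
  have hG := (hasDerivAt_exp_mul_Ei hp).comp_hasFDerivAt p h12
  have hX : X₃ b = fun q => ![b * (exp (-b * (q 1 + q 2)) * Ei (-b * (q 1 + q 2))), -1,
      2 * b * ((q 1 + q 2) * (exp (-b * (q 1 + q 2)) * Ei (-b * (q 1 + q 2)))) + 1] := by
    ext q i
    fin_cases i <;> simp [X₃] <;> ring
  rw [hX]
  refine (fderiv_vec3_apply (hG.const_mul b) (hasFDerivAt_const (-1 : ℝ) p)
    (((h12.fun_mul hG).const_mul (2 * b)).add_const 1) v).trans ?_
  ext i
  fin_cases i <;> simp <;> field_simp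
  ring

/-- For `b ≠ 0`, on the open region `U = {(x,y,z) : b(y+z) < 0}` the vector
fields `X₁, X₂, X₃` satisfy `[X₂, X₃] = X₁`, `[X₁, X₂] = 0` and `[X₁, X₃] = 0`,
so they span a Lie algebra isomorphic to the three-dimensional Heisenberg Lie
algebra. -/
theorem stmt_5 (b : ℝ) (hb : b ≠ 0) (p : Fin 3 → ℝ)
    (hp : p ∈ {q : Fin 3 → ℝ | b * (q 1 + q 2) < 0}) :
    lieBr (X₂ b) (X₃ b) p = X₁ b p ∧
    lieBr (X₁ b) (X₂ b) p = 0 ∧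
    lieBr (X₁ b) (X₃ b) p = 0 := by
  have hp' : b * (p 1 + p 2) < 0 := hp
  have hs : p 1 + p 2 ≠ 0 := right_ne_zero_of_mul hp'.ne
  simp only [lieBr, fderiv_X₁, fderiv_X₂_apply, fderiv_X₃_apply hp']
  refine ⟨?_, ?_, ?_⟩ <;> ext i <;> fin_cases i <;> simp [X₁, X₂, X₃]
  all_goals field_simp; ring
end

section
/- On ℝ³ the pair (Λ, E) with Λ^{12} = (e^{2x} − 1)/4, Λ^{13} = (e^{2x} − 1)/4, Λ^{23} = −½(y + z + 1 − e^{2x}) and E = (0, −½, ½) is a Jacobi structure: at every point, (i) Σ_l [Λ^{1l}∂_l Λ^{23} + Λ^{2l}∂_l Λ^{31} + Λ^{3l}∂_l Λ^{12}] + E¹Λ^{23} + E²Λ^{31} + E³Λ^{12} = 0, and (ii) Σ_l E^l ∂_l Λ^{μν} − Σ_l Λ^{lν} ∂_l E^μ − Σ_l Λ^{μl} ∂_l E^ν = 0 for all μ,ν ∈ {1,2,3}. -/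
open Real

/-- Partial derivative `∂_μ f` on `ℝ³`. -/
noncomputable def pd (μ : Fin 3) (f : (Fin 3 → ℝ) → ℝ) (p : Fin 3 → ℝ) : ℝ :=
  fderiv ℝ f p (Pi.single μ 1)

/-- The components `Λ^{μν}` of the bivector with `Λ^{12} = (e^{2x} − 1)/4`,
`Λ^{13} = (e^{2x} − 1)/4`, `Λ^{23} = −½(y + z + 1 − e^{2x})`, extended
antisymmetrically. -/
noncomputable def L : Fin 3 → Fin 3 → (Fin 3 → ℝ) → ℝ :=
  ![![fun _ => 0,
     fun p => (exp (2 * p 0) - 1) / 4,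
     fun p => (exp (2 * p 0) - 1) / 4],
    ![fun p => -((exp (2 * p 0) - 1) / 4),
     fun _ => 0,
     fun p => -((p 1 + p 2 + 1 - exp (2 * p 0)) / 2)],
    ![fun p => -((exp (2 * p 0) - 1) / 4),
     fun p => (p 1 + p 2 + 1 - exp (2 * p 0)) / 2,
     fun _ => 0]]

/-- The components of the vector field `E = (0, −½, ½)`. -/
noncomputable def E : Fin 3 → (Fin 3 → ℝ) → ℝ :=
  ![fun _ => 0, fun _ => -(1/2), fun _ => 1/2]

/-- Partial derivatives of a function depending on `x` through `exp (2 * x)` and affinely on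
`y` and `z`. -/
theorem pd_exp_add_affine (a b c d : ℝ) (l : Fin 3) (p : Fin 3 → ℝ) :
    pd l (fun q => a * exp (2 * q 0) + b * q 1 + c * q 2 + d) p =
      ![2 * a * exp (2 * p 0), b, c] l := by
  have hx (i : Fin 3) : HasFDerivAt (fun q : Fin 3 → ℝ => q i)
      (ContinuousLinearMap.proj i : (Fin 3 → ℝ) →L[ℝ] ℝ) p := hasFDerivAt_apply i p
  have h := (((((hx 0).const_mul 2).exp.const_mul a).add ((hx 1).const_mul b)).add
    ((hx 2).const_mul c)).add_const d
  have h' : fderiv ℝ (fun q : Fin 3 → ℝ => a * exp (2 * q 0) + b * q 1 + c * q 2 + d) p = _ :=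
    h.fderiv
  rw [pd, h']
  fin_cases l <;> simp
  ring

/-- Each `Λ^{μν}` is an affine combination of `exp (2 * x)`, `y` and `z`. -/
theorem L_eq (μ ν : Fin 3) :
    L μ ν = fun q =>
      (!![0, 1 / 4, 1 / 4; -(1 / 4), 0, 1 / 2; -(1 / 4), -(1 / 2), 0] : Matrix _ _ ℝ) μ ν
          * exp (2 * q 0)
        + (!![0, 0, 0; 0, 0, -(1 / 2); 0, 1 / 2, 0] : Matrix _ _ ℝ) μ ν * q 1
        + (!![0, 0, 0; 0, 0, -(1 / 2); 0, 1 / 2, 0] : Matrix _ _ ℝ) μ ν * q 2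
        + (!![0, -(1 / 4), -(1 / 4); 1 / 4, 0, -(1 / 2); 1 / 4, 1 / 2, 0] : Matrix _ _ ℝ) μ ν := by
  funext q
  fin_cases μ <;> fin_cases ν <;> simp [L] <;> ring

theorem pd_E (l μ : Fin 3) (p : Fin 3 → ℝ) : pd l (E μ) p = 0 := by
  fin_cases μ <;> simp [pd, E]

/-- The pair `(Λ, E)` with `Λ^{12} = (e^{2x} − 1)/4`, `Λ^{13} = (e^{2x} − 1)/4`,
`Λ^{23} = −½(y + z + 1 − e^{2x})`, `E = (0, −½, ½)` is a Jacobi structure on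
`ℝ³`: (i) the coordinate form of `[Λ,Λ] = 2E∧Λ` and (ii) the coordinate form
of `L_E Λ = 0` hold at every point. -/
theorem stmt_8 (p : Fin 3 → ℝ) :
    ((∑ l : Fin 3, (L 0 l p * pd l (L 1 2) p + L 1 l p * pd l (L 2 0) p
        + L 2 l p * pd l (L 0 1) p))
      + E 0 p * L 1 2 p + E 1 p * L 2 0 p + E 2 p * L 0 1 p = 0) ∧
    (∀ μ ν : Fin 3,
      (∑ l : Fin 3, E l p * pd l (L μ ν) p)
        - (∑ l : Fin 3, L l ν p * pd l (E μ) p)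
        - (∑ l : Fin 3, L μ l p * pd l (E ν) p) = 0) := by
  have hL (l μ ν : Fin 3) :=
    (congrArg (pd l · p) (L_eq μ ν)).trans (pd_exp_add_affine _ _ _ _ l p)
  constructor
  · simp only [hL, Fin.sum_univ_three]
    simp [L, E]
    ring
  · intro μ ν
    simp only [hL, pd_E, Fin.sum_univ_three]
    fin_cases μ <;> fin_cases ν <;> simp [E]
end

section
/- On ℝ³ with the Jacobi structure Λ^{12} = (e^{2x} − 1)/4, Λ^{13} = (e^{2x} − 1)/4, Λ^{23} = −½(y + z + 1 − e^{2x}), E = (0, −½, ½), the functions f₁ = 2(y + z + 2)(x − y), f₂ = 1 + y + z, f₃ = 1 satisfy {f₁, f₂} = −f₂ − f₃ and {f₁, f₃} = −f₂ − f₃, so f₁, f₂, f₃ span a three-dimensional Lie algebra under the Jacobi bracket. -/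
open Real

/-- The Jacobi bracket of `f, g`:
`{f,g} = Σ_{μ,ν} Λ^{μν}·(∂_μ f)·(∂_ν g) + f·(Eg) − g·(Ef)`. -/
noncomputable def jb (Λ : (Fin 3 → ℝ) → Fin 3 → Fin 3 → ℝ)
    (E : (Fin 3 → ℝ) → Fin 3 → ℝ) (f g : (Fin 3 → ℝ) → ℝ) (p : Fin 3 → ℝ) : ℝ :=
  (∑ μ : Fin 3, ∑ ν : Fin 3, Λ p μ ν * pd μ f p * pd ν g p)
    + f p * (∑ μ : Fin 3, E p μ * pd μ g p)
    - g p * (∑ μ : Fin 3, E p μ * pd μ f p)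

/-- The bivector with `Λ^{12} = (e^{2x} − 1)/4`, `Λ^{13} = (e^{2x} − 1)/4`,
`Λ^{23} = −½(y + z + 1 − e^{2x})`. -/
noncomputable def Lam : (Fin 3 → ℝ) → Fin 3 → Fin 3 → ℝ := fun p =>
  ![![0, (exp (2 * p 0) - 1) / 4, (exp (2 * p 0) - 1) / 4],
    ![-((exp (2 * p 0) - 1) / 4), 0, -((p 1 + p 2 + 1 - exp (2 * p 0)) / 2)],
    ![-((exp (2 * p 0) - 1) / 4), (p 1 + p 2 + 1 - exp (2 * p 0)) / 2, 0]]

/-- The Reeb vector field `E = (0, −½, ½)`. -/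
noncomputable def Evec : (Fin 3 → ℝ) → Fin 3 → ℝ := fun _ => ![0, -(1/2), 1/2]

/-- f₁ = 2(y + z + 2)(x − y). -/
noncomputable def f₁ : (Fin 3 → ℝ) → ℝ := fun q => 2 * (q 1 + q 2 + 2) * (q 0 - q 1)

/-- f₂ = 1 + y + z. -/
noncomputable def f₂ : (Fin 3 → ℝ) → ℝ := fun q => 1 + q 1 + q 2

/-- f₃ = 1. -/
noncomputable def f₃ : (Fin 3 → ℝ) → ℝ := fun _ => 1

theorem hasFDerivAt_coord (i : Fin 3) (p : Fin 3 → ℝ) :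
    HasFDerivAt (fun q : Fin 3 → ℝ => q i)
      (ContinuousLinearMap.proj (R := ℝ) (φ := fun _ : Fin 3 => ℝ) i) p :=
  (ContinuousLinearMap.proj (R := ℝ) (φ := fun _ : Fin 3 => ℝ) i).hasFDerivAt

theorem pd_f₁ (μ : Fin 3) (p : Fin 3 → ℝ) :
    pd μ f₁ p = ![2 * (p 1 + p 2 + 2), 2 * (p 0 - p 1) - 2 * (p 1 + p 2 + 2),
      2 * (p 0 - p 1)] μ := by
  have h := ((((hasFDerivAt_coord 1 p).add (hasFDerivAt_coord 2 p)).add_const 2).const_mul 2).mul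
    ((hasFDerivAt_coord 0 p).sub (hasFDerivAt_coord 1 p))
  have h' : fderiv ℝ f₁ p = _ := h.fderiv
  rw [pd, h']
  fin_cases μ <;> simp <;> ring

theorem pd_f₂ (μ : Fin 3) (p : Fin 3 → ℝ) : pd μ f₂ p = ![0, 1, 1] μ := by
  have h := ((hasFDerivAt_coord 1 p).const_add 1).add (hasFDerivAt_coord 2 p)
  have h' : fderiv ℝ f₂ p = _ := h.fderiv
  rw [pd, h']
  fin_cases μ <;> simp

theorem pd_f₃ (μ : Fin 3) (p : Fin 3 → ℝ) : pd μ f₃ p = 0 := by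
  have h : HasFDerivAt f₃ (0 : (Fin 3 → ℝ) →L[ℝ] ℝ) p := hasFDerivAt_const 1 p
  rw [pd, h.fderiv, zero_apply]

/-- With the Jacobi structure `(Λ, E)` above on `ℝ³`, the functions
`f₁ = 2(y + z + 2)(x − y)`, `f₂ = 1 + y + z`, `f₃ = 1` satisfy
`{f₁, f₂} = −f₂ − f₃` and `{f₁, f₃} = −f₂ − f₃`, so `f₁, f₂, f₃` span a
three-dimensional Lie algebra under the Jacobi bracket. -/
theorem stmt_11 (p : Fin 3 → ℝ) :
    jb Lam Evec f₁ f₂ p = -f₂ p - f₃ p ∧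
    jb Lam Evec f₁ f₃ p = -f₂ p - f₃ p := by
  constructor
  · simp only [jb, pd_f₁, pd_f₂, Fin.sum_univ_three]
    simp [Lam, Evec, f₁, f₂, f₃]
    ring
  · simp only [jb, pd_f₁, pd_f₃, Fin.sum_univ_three]
    simp [Evec, f₁, f₂, f₃]
    ring
end
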